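/- (Garling's alternative) Let σ be a real structure on ℂl(V). If the real quadratic form Q_σ on V is positive definite, then the σ-product on ℂl(V) is positive definite. If Q_σ is not positive definite, then the σ-product is neutral, i.e., it is nondegenerate with signature (2^{n−1}, 2^{n−1}). -/

import Mathlib

noncomputable section

open TensorProduct

variable {V : Type*} [AddCommGroup V] [Module ℝ V]

/-- `ℂl(V)`: the complexified Clifford algebra of `(V, Q)` (convention `v² = Q(v)·1`). -/
abbrev CCl (Q : QuadraticForm ℝ V) := CliffordAlgebra (Q.baseChange ℂ)

/-- The canonical embedding of the real vector space `V` into `ℂl(V)`. -/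
def ιr (Q : QuadraticForm ℝ V) (v : V) : CCl Q :=
  CliffordAlgebra.ι (Q.baseChange ℂ) ((1 : ℂ) ⊗ₜ[ℝ] v)

/-- `V^ℂ`: the complexification of `V`, sitting inside `ℂl(V)`. -/
def VC (Q : QuadraticForm ℝ V) : Submodule ℂ (CCl Q) :=
  LinearMap.range (CliffordAlgebra.ι (Q.baseChange ℂ))

/-- A real structure on `ℂl(V)`: an involutive conjugate-linear algebra automorphism
stabilizing `V^ℂ`. -/
structure RealStructure (Q : QuadraticForm ℝ V) where
  toFun : CCl Q → CCl Q
  map_add' : ∀ x y, toFun (x + y) = toFun x + toFun y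
  map_mul' : ∀ x y, toFun (x * y) = toFun x * toFun y
  map_smul' : ∀ (z : ℂ) (x : CCl Q), toFun (z • x) = (starRingEnd ℂ z) • toFun x
  map_one' : toFun 1 = 1
  invol : ∀ x, toFun (toFun x) = x
  stable : ∀ x ∈ VC Q, toFun x ∈ VC Q

namespace RealStructure

theorem map_zero' {Q : QuadraticForm ℝ V} (σ : RealStructure Q) : σ.toFun 0 = 0 := by
  have h := σ.map_smul' 0 0
  simpa using h

end RealStructure

/-- The fixed points of a real structure, as a real submodule of `ℂl(V)`. -/
def fixedPoints {Q : QuadraticForm ℝ V} (σ : RealStructure Q) : Submodule ℝ (CCl Q) where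
  carrier := {x | σ.toFun x = x}
  add_mem' := by
    intro a b ha hb
    simp only [Set.mem_setOf_eq] at *
    rw [σ.map_add', ha, hb]
  zero_mem' := σ.map_zero'
  smul_mem' := by
    intro r x hx
    simp only [Set.mem_setOf_eq] at *
    rw [← Complex.coe_smul, σ.map_smul', hx]
    simp [Complex.conj_ofReal]

/-- `V_σ = {w ∈ V^ℂ : σ(w) = w}`, as a real submodule of `ℂl(V)`. -/
def VFix {Q : QuadraticForm ℝ V} (σ : RealStructure Q) : Submodule ℝ (CCl Q) :=
  (VC Q).restrictScalars ℝ ⊓ fixedPoints σ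

/-- Multiplication by `i`, as a real-linear endomorphism of `ℂl(V)`. -/
def mulI (Q : QuadraticForm ℝ V) : CCl Q →ₗ[ℝ] CCl Q where
  toFun x := Complex.I • x
  map_add' x y := smul_add _ x y
  map_smul' r x := smul_comm Complex.I r x

/-- The real subspace `V ⊆ V^ℂ ⊆ ℂl(V)`. -/
def Vreal (Q : QuadraticForm ℝ V) : Submodule ℝ (CCl Q) :=
  Submodule.span ℝ (Set.range (ιr Q))

/-- The canonical real structure `c` (characterized by fixing `V` pointwise). -/
def IsCanonicalC {Q : QuadraticForm ℝ V} (c : RealStructure Q) : Prop :=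
  ∀ v : V, c.toFun (ιr Q v) = ιr Q v

/-- `σ` is admissible iff it commutes with the canonical real structure `c`. -/
def Admissible {Q : QuadraticForm ℝ V} (c σ : RealStructure Q) : Prop :=
  ∀ x, σ.toFun (c.toFun x) = c.toFun (σ.toFun x)

/-- Nondegeneracy of a real quadratic form, via its polar form. -/
def QFNondeg (Q : QuadraticForm ℝ V) : Prop :=
  ∀ v : V, (∀ w : V, QuadraticMap.polar Q v w = 0) → v = 0

/-- A hermitian sesquilinear form (conjugate-linear in the first argument). -/
structure SesqForm (K : Type*) [AddCommGroup K] [Module ℂ K] where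
  form : K → K → ℂ
  add_left : ∀ x y z : K, form (x + y) z = form x z + form y z
  add_right : ∀ x y z : K, form x (y + z) = form x y + form x z
  smul_left : ∀ (a : ℂ) (x y : K), form (a • x) y = starRingEnd ℂ a * form x y
  smul_right : ∀ (a : ℂ) (x y : K), form x (a • y) = a * form x y
  herm : ∀ x y : K, form y x = starRingEnd ℂ (form x y)

section KreinDefs

variable {K : Type*} [AddCommGroup K] [Module ℂ K]

/-- Nondegeneracy: a nondegenerate hermitian form is a Krein product. -/
def SesqForm.Nondeg (h : SesqForm K) : Prop :=
  ∀ x : K, (∀ y : K, h.form x y = 0) → x = 0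

/-- Positive definiteness of a sesquilinear form. -/
def FPosDef (f : K → K → ℂ) : Prop := ∀ x : K, x ≠ 0 → ∃ r : ℝ, 0 < r ∧ f x x = r

/-- Negative definiteness of a sesquilinear form. -/
def FNegDef (f : K → K → ℂ) : Prop := ∀ x : K, x ≠ 0 → ∃ r : ℝ, r < 0 ∧ f x x = r

/-- Definiteness of a sesquilinear form. -/
def FDefinite (f : K → K → ℂ) : Prop := FPosDef f ∨ FNegDef f

/-- `f` is neutral: it admits an orthogonal decomposition into a positive definite
and a negative definite part of equal dimensions (equal indices of inertia). -/
def FNeutral (f : K → K → ℂ) : Prop :=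
  ∃ P N : Submodule ℂ K, P ⊓ N = ⊥ ∧ P ⊔ N = ⊤
    ∧ (∀ x ∈ P, ∀ y ∈ N, f x y = 0)
    ∧ (∀ x ∈ P, x ≠ 0 → ∃ r : ℝ, 0 < r ∧ f x x = r)
    ∧ (∀ y ∈ N, y ≠ 0 → ∃ r : ℝ, r < 0 ∧ f y y = r)
    ∧ Module.finrank ℂ P = Module.finrank ℂ N

end KreinDefs

/-- The σ-product `(a,b)_σ = τ_n(σ(aᵀ)b)` on `ℂl(V)`. -/
def sprod {Q : QuadraticForm ℝ V} (σ : RealStructure Q) (τ : CCl Q →ₗ[ℂ] ℂ)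
    (a b : CCl Q) : ℂ :=
  τ (σ.toFun (CliffordAlgebra.reverse a) * b)

section AnticommutingGenerators

variable {R A ι : Type*} [Field R] [Ring A] [Algebra R A] [LinearOrder ι]

/-- The ordered product of the generators `e i`, `i ∈ I`. -/
def orderedMonomial (e : ι → A) (I : Finset ι) : A := (I.sort.map e).prod

/-- The product of the generators `e i`, `i ∈ I`, in decreasing order. -/
def reversedMonomial (e : ι → A) (I : Finset ι) : A := (I.sort.reverse.map e).prod

/-- The sign in `e i * e j = commSign R i j • (e j * e i)`. -/
def commSign (R : Type*) {ι : Type*} [Field R] [LinearOrder ι] (i j : ι) : R :=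
  if j = i then 1 else -1

variable {e : ι → A} {d : ι → R}

theorem mul_list_prod_eq_commSign_smul (hanti : ∀ i j, i ≠ j → e i * e j = -(e j * e i))
    (i : ι) (l : List ι) :
    e i * (l.map e).prod = (l.map (commSign R i)).prod • ((l.map e).prod * e i) := by
  induction l with
  | nil => simp
  | cons a t ih =>
    have h : e i * e a = commSign R i a • (e a * e i) := by
      unfold commSign
      split_ifs with h
      · simp [h]
      · simp [hanti i a (Ne.symm h)]
    simp only [List.map_cons, List.prod_cons]
    rw [← mul_assoc, h, smul_mul_assoc, mul_assoc, ih, mul_smul_comm, smul_smul, mul_assoc]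

theorem trace_list_prod_eq_zero (hsq : ∀ i, e i * e i = algebraMap R A (d i))
    (hanti : ∀ i j, i ≠ j → e i * e j = -(e j * e i)) (hd : ∀ i, d i ≠ 0)
    (τ : A →ₗ[R] R) (hτ : ∀ a b, τ (a * b) = τ (b * a)) (i : ι) (l : List ι)
    (hl : (l.map (commSign R i)).prod ≠ 1) : τ (l.map e).prod = 0 := by
  have h1 : τ (e i * (l.map e).prod * e i) = d i * τ (l.map e).prod := by
    rw [hτ, ← mul_assoc, hsq, ← Algebra.smul_def, map_smul, smul_eq_mul]
  have h2 : τ (e i * (l.map e).prod * e i)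
      = (l.map (commSign R i)).prod * (d i * τ (l.map e).prod) := by
    rw [mul_list_prod_eq_commSign_smul (R := R) hanti, smul_mul_assoc, mul_assoc, hsq, map_smul,
      ← Algebra.commutes, ← Algebra.smul_def, map_smul, smul_eq_mul, smul_eq_mul]
  by_contra h0
  exact hl (mul_right_cancel₀ (mul_ne_zero (hd i) h0) (by rw [one_mul, ← h2, h1]))

theorem reversed_list_prod_mul_list_prod {κ : Type*} {e : κ → A} {d : κ → R}
    (hsq : ∀ i, e i * e i = algebraMap R A (d i)) (l : List κ) : (l.reverse.map e).prod * (l.map e).prod = algebraMap R A (l.map d).prod := by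
  induction l with
  | nil => simp
  | cons a t ih =>
    simp only [List.reverse_cons, List.map_append, List.map_cons, List.map_nil, List.prod_append,
      List.prod_cons, List.prod_nil, mul_one]
    rw [mul_assoc, ← mul_assoc (e a), hsq, Algebra.left_comm, ih, map_mul]

theorem list_prod_map_sort {M : Type*} [CommMonoid M] (f : ι → M) (I : Finset ι) :
    (I.sort.map f).prod = ∏ i ∈ I, f i := by
  conv_rhs => rw [← Finset.sort_toFinset (r := (· ≤ ·)) I]
  rw [List.prod_toFinset _ (Finset.sort_nodup _ _)]

theorem prod_commSign (i : ι) (I : Finset ι) :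
    ∏ j ∈ I, commSign R i j = (-1) ^ I.card * if i ∈ I then -1 else 1 := by
  have : ∀ j, commSign R i j = -1 * if j = i then -1 else 1 := by
    intro j; unfold commSign; split_ifs <;> simp
  simp only [this]
  rw [Finset.prod_mul_distrib, Finset.prod_const, Finset.prod_ite_eq']

theorem eq_of_prod_commSign_eq_one [CharZero R] [Fintype ι] (hn : Even (Fintype.card ι))
    {I J : Finset ι}
    (h : ∀ i, (∏ j ∈ I, commSign R i j) * ∏ j ∈ J, commSign R i j = 1) : I = J := by
  simp only [prod_commSign] at h
  have key : ∀ K : Finset ι, ∏ i, ((-1 : R) ^ K.card * if i ∈ K then -1 else 1)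
      = (-1) ^ K.card := by
    intro K
    rw [Finset.prod_mul_distrib, Finset.prod_const, Finset.card_univ, ← pow_mul,
      (hn.mul_left _).neg_one_pow, one_mul, Finset.prod_ite_mem, Finset.univ_inter,
      Finset.prod_const]
  have hIJ : (-1 : R) ^ I.card * (-1) ^ J.card = 1 := by
    rw [← key I, ← key J, ← Finset.prod_mul_distrib]
    exact Finset.prod_eq_one fun i _ => h i
  ext i
  have hi : (if i ∈ I then (-1 : R) else 1) * (if i ∈ J then -1 else 1) = 1 := by
    linear_combination h i - (if i ∈ I then (-1 : R) else 1) * (if i ∈ J then -1 else 1) * hIJ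
  have hne : (-1 : R) ≠ 1 := by norm_num
  by_cases h1 : i ∈ I <;> by_cases h2 : i ∈ J <;> simp_all

theorem trace_reversedMonomial_mul_orderedMonomial [CharZero R] [Fintype ι]
    (hn : Even (Fintype.card ι)) (hsq : ∀ i, e i * e i = algebraMap R A (d i))
    (hanti : ∀ i j, i ≠ j → e i * e j = -(e j * e i)) (hd : ∀ i, d i ≠ 0)
    (τ : A →ₗ[R] R) (hτ1 : τ 1 = 1) (hτ : ∀ a b, τ (a * b) = τ (b * a)) (I J : Finset ι) :
    τ (reversedMonomial e I * orderedMonomial e J) = if I = J then ∏ i ∈ I, d i else 0 := by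
  split_ifs with h
  · subst h
    rw [reversedMonomial, orderedMonomial, reversed_list_prod_mul_list_prod hsq,
      list_prod_map_sort, Algebra.algebraMap_eq_smul_one, map_smul, hτ1, smul_eq_mul, mul_one]
  · have : ∃ i, (∏ j ∈ I, commSign R i j) * ∏ j ∈ J, commSign R i j ≠ 1 := by
      by_contra! hc
      exact h (eq_of_prod_commSign_eq_one hn hc)
    obtain ⟨i, hi⟩ := this
    rw [reversedMonomial, orderedMonomial, ← List.prod_append, ← List.map_append]
    refine trace_list_prod_eq_zero hsq hanti hd τ hτ i _ ?_
    rwa [List.map_append, List.prod_append, List.map_reverse, List.prod_reverse,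
      list_prod_map_sort, list_prod_map_sort]

theorem linearIndependent_orderedMonomial [CharZero R] [Fintype ι]
    (hn : Even (Fintype.card ι)) (hsq : ∀ i, e i * e i = algebraMap R A (d i))
    (hanti : ∀ i j, i ≠ j → e i * e j = -(e j * e i)) (hd : ∀ i, d i ≠ 0)
    (τ : A →ₗ[R] R) (hτ1 : τ 1 = 1) (hτ : ∀ a b, τ (a * b) = τ (b * a)) :
    LinearIndependent R (orderedMonomial e) := by
  rw [Fintype.linearIndependent_iff]
  intro g hg I
  have h := congrArg (fun x => τ (reversedMonomial e I * x)) hg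
  simp only [Finset.mul_sum, mul_smul_comm, map_sum, map_smul,
    trace_reversedMonomial_mul_orderedMonomial hn hsq hanti hd τ hτ1 hτ, mul_zero, map_zero,
    smul_eq_mul, mul_ite, Finset.sum_ite_eq, Finset.mem_univ, if_true] at h
  exact (mul_eq_zero.mp h).resolve_right (Finset.prod_ne_zero_iff.mpr fun i _ => hd i)

theorem exists_mul_sorted_list_prod (hsq : ∀ i, e i * e i = algebraMap R A (d i))
    (hanti : ∀ i j, i ≠ j → e i * e j = -(e j * e i)) (i : ι) (l : List ι)
    (hl : l.Pairwise (· < ·)) :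
    ∃ (c : R) (l' : List ι), l'.Pairwise (· < ·) ∧ (∀ x ∈ l', x = i ∨ x ∈ l) ∧
      e i * (l.map e).prod = c • (l'.map e).prod := by
  induction l with
  | nil => exact ⟨1, [i], by simp, by simp, by simp⟩
  | cons a t ih =>
    rw [List.pairwise_cons] at hl
    rcases lt_trichotomy i a with h | h | h
    · refine ⟨1, i :: a :: t, ?_, by simp, by simp⟩
      rw [List.pairwise_cons, List.pairwise_cons]
      refine ⟨fun x hx => ?_, hl⟩
      rcases List.mem_cons.mp hx with rfl | hx
      exacts [h, h.trans (hl.1 x hx)]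
    · refine ⟨d a, t, hl.2, fun x hx => .inr (List.mem_cons_of_mem _ hx), ?_⟩
      rw [h, List.map_cons, List.prod_cons, ← mul_assoc, hsq, Algebra.smul_def]
    · obtain ⟨c, l', h1, h2, h3⟩ := ih hl.2
      refine ⟨-c, a :: l', ?_, ?_, ?_⟩
      · rw [List.pairwise_cons]
        refine ⟨fun x hx => ?_, h1⟩
        rcases h2 x hx with rfl | hx
        exacts [h, hl.1 x hx]
      · intro x hx
        rcases List.mem_cons.mp hx with rfl | hx
        · simp
        · rcases h2 x hx with rfl | hx <;> simp [*]
      · rw [List.map_cons, List.prod_cons, ← mul_assoc, hanti i a h.ne', neg_mul, mul_assoc, h3,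
          List.map_cons, List.prod_cons, mul_smul_comm, neg_smul]

theorem mul_mem_span_orderedMonomial (hsq : ∀ i, e i * e i = algebraMap R A (d i))
    (hanti : ∀ i j, i ≠ j → e i * e j = -(e j * e i)) (i : ι) {x : A}
    (hx : x ∈ Submodule.span R (Set.range (orderedMonomial e))) :
    e i * x ∈ Submodule.span R (Set.range (orderedMonomial e)) := by
  induction hx using Submodule.span_induction with
  | mem x h =>
    obtain ⟨I, rfl⟩ := h
    obtain ⟨c, l, hl, -, h⟩ := exists_mul_sorted_list_prod hsq hanti i I.sort
      (Finset.sortedLT_sort I).pairwise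
    rw [orderedMonomial, h]
    refine Submodule.smul_mem _ _ (Submodule.subset_span ⟨l.toFinset, ?_⟩)
    rw [orderedMonomial, (List.toFinset_sort (r := (· ≤ ·)) (hl.imp ne_of_lt)).2 (hl.imp le_of_lt)]
  | zero => simp
  | add x y _ _ hx hy => rw [mul_add]; exact add_mem hx hy
  | smul c x _ hx => rw [mul_smul_comm]; exact Submodule.smul_mem _ _ hx

theorem span_orderedMonomial_eq_top (hsq : ∀ i, e i * e i = algebraMap R A (d i))
    (hanti : ∀ i j, i ≠ j → e i * e j = -(e j * e i))
    (hgen : Algebra.adjoin R (Set.range e) = ⊤) :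
    ⊤ ≤ Submodule.span R (Set.range (orderedMonomial e)) := by
  have key : ∀ a ∈ Algebra.adjoin R (Set.range e),
      ∀ x ∈ Submodule.span R (Set.range (orderedMonomial e)),
        a * x ∈ Submodule.span R (Set.range (orderedMonomial e)) := by
    intro a ha
    induction ha using Algebra.adjoin_induction with
    | mem a ha =>
      obtain ⟨i, rfl⟩ := ha
      exact fun x hx => mul_mem_span_orderedMonomial hsq hanti i hx
    | algebraMap r =>
      intro x hx
      rw [← Algebra.smul_def]
      exact Submodule.smul_mem _ _ hx
    | add a b _ _ ha hb => intro x hx; rw [add_mul]; exact add_mem (ha x hx) (hb x hx)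
    | mul a b _ _ ha hb => intro x hx; rw [mul_assoc]; exact ha _ (hb x hx)
  intro a _
  have h1 : (1 : A) ∈ Submodule.span R (Set.range (orderedMonomial e)) :=
    Submodule.subset_span ⟨∅, by simp [orderedMonomial]⟩
  simpa using key a (by rw [hgen]; trivial) 1 h1

end AnticommutingGenerators

section DiagonalHermitianForm

variable {K κ : Type*} [AddCommGroup K] [Module ℂ K] [Fintype κ]

theorem diagonal_form_self (b : Module.Basis κ ℂ K) (d : κ → ℝ) {f : K → K → ℂ}
    (hf : ∀ x y, f x y = ∑ k, starRingEnd ℂ (b.repr x k) * b.repr y k * d k) (x : K) :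
    f x x = ((∑ k, Complex.normSq (b.repr x k) * d k : ℝ) : ℂ) := by
  rw [hf]
  push_cast
  exact Finset.sum_congr rfl fun k _ => by rw [Complex.normSq_eq_conj_mul_self]

theorem exists_repr_ne_zero (b : Module.Basis κ ℂ K) {x : K} (hx : x ≠ 0) :
    ∃ k, b.repr x k ≠ 0 := by
  by_contra! h
  exact hx (b.repr.map_eq_zero_iff.mp (Finsupp.ext h))

theorem diagonal_form_self_pos (b : Module.Basis κ ℂ K) (d : κ → ℝ) {f : K → K → ℂ}
    (hf : ∀ x y, f x y = ∑ k, starRingEnd ℂ (b.repr x k) * b.repr y k * d k) {s : Set κ}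
    (hs : ∀ k ∈ s, 0 < d k) {x : K} (hx : x ∈ Submodule.span ℂ (b '' s)) (hx0 : x ≠ 0) :
    ∃ r : ℝ, 0 < r ∧ f x x = r := by
  refine ⟨_, ?_, diagonal_form_self b d hf x⟩
  rw [b.mem_span_image] at hx
  obtain ⟨k, hk⟩ := exists_repr_ne_zero b hx0
  refine Finset.sum_pos' (fun j _ => ?_) ⟨k, Finset.mem_univ _, ?_⟩
  · by_cases hj : b.repr x j = 0
    · simp [hj]
    · exact mul_nonneg (Complex.normSq_nonneg _) (hs j (hx (by simpa using hj))).le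
  · exact mul_pos (Complex.normSq_pos.mpr hk) (hs k (hx (by simpa using hk)))

theorem diagonal_form_self_neg (b : Module.Basis κ ℂ K) (d : κ → ℝ) {f : K → K → ℂ}
    (hf : ∀ x y, f x y = ∑ k, starRingEnd ℂ (b.repr x k) * b.repr y k * d k) {s : Set κ}
    (hs : ∀ k ∈ s, d k < 0) {x : K} (hx : x ∈ Submodule.span ℂ (b '' s)) (hx0 : x ≠ 0) :
    ∃ r : ℝ, r < 0 ∧ f x x = r := by
  obtain ⟨r, hr, h⟩ := diagonal_form_self_pos b (fun k => -d k) (f := fun x y => -f x y)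
    (by intro x y; simp [hf]) (fun k hk => neg_pos.mpr (hs k hk)) hx hx0
  exact ⟨-r, neg_lt_zero.mpr hr, by rw [Complex.ofReal_neg, ← h, neg_neg]⟩

theorem diagonal_form_eq_zero_of_disjoint (b : Module.Basis κ ℂ K) (d : κ → ℝ) {f : K → K → ℂ}
    (hf : ∀ x y, f x y = ∑ k, starRingEnd ℂ (b.repr x k) * b.repr y k * d k) {s t : Set κ}
    (hst : Disjoint s t) {x y : K} (hx : x ∈ Submodule.span ℂ (b '' s))
    (hy : y ∈ Submodule.span ℂ (b '' t)) : f x y = 0 := by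
  rw [b.mem_span_image] at hx hy
  rw [hf]
  refine Finset.sum_eq_zero fun k _ => ?_
  by_cases h1 : b.repr x k = 0
  · simp [h1]
  · by_cases h2 : b.repr y k = 0
    · simp [h2]
    · exact (Set.disjoint_left.mp hst (hx (by simpa using h1)) (hy (by simpa using h2))).elim

theorem diagonal_form_nondegenerate (b : Module.Basis κ ℂ K) {d : κ → ℝ} (hd : ∀ k, d k ≠ 0)
    {f : K → K → ℂ}
    (hf : ∀ x y, f x y = ∑ k, starRingEnd ℂ (b.repr x k) * b.repr y k * d k) {x : K}
    (hx : ∀ y, f x y = 0) : x = 0 := by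
  classical
  by_contra hx0
  obtain ⟨k, hk⟩ := exists_repr_ne_zero b hx0
  have h := hx (b k)
  rw [hf, Finset.sum_eq_single k] at h
  · simp [hk, hd k] at h
  · intro j _ hj; simp [hj.symm]
  · simp

theorem finrank_span_basis_image {ι : Type*} (b : Module.Basis ι ℂ K) (s : Finset ι) :
    Module.finrank ℂ (Submodule.span ℂ (b '' s)) = s.card := by
  classical
  rw [← Finset.coe_image, finrank_span_finset_eq_card, Finset.card_image_of_injective _ b.injective]
  rw [Finset.coe_image]
  exact (b.linearIndependent.linearIndepOn _).id_image

end DiagonalHermitianForm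

theorem card_prod_pos_and_prod_neg {ι : Type*} [Fintype ι] {d : ι → ℝ} (hd : ∀ i, d i ≠ 0)
    {i₀ : ι} (hi₀ : d i₀ < 0) :
    ({I : Finset ι | 0 < ∏ i ∈ I, d i} : Finset (Finset ι)).card = 2 ^ (Fintype.card ι - 1) ∧
    ({I : Finset ι | ∏ i ∈ I, d i < 0} : Finset (Finset ι)).card = 2 ^ (Fintype.card ι - 1) := by
  classical
  have hprod : ∀ I : Finset ι, ∏ i ∈ I, d i ≠ 0 := fun I =>
    Finset.prod_ne_zero_iff.mpr fun i _ => hd i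
  have hsum : ∑ I : Finset ι, ((SignType.sign (∏ i ∈ I, d i) : SignType) : ℤ) = 0 := by
    have h := Finset.prod_one_add (Finset.univ : Finset ι)
      (f := fun i => ((SignType.sign (d i) : SignType) : ℤ))
    rw [Finset.powerset_univ, Finset.prod_eq_zero (Finset.mem_univ i₀) (by simp [hi₀])] at h
    rw [h]
    refine Finset.sum_congr rfl fun I _ => ?_
    have := map_prod signHom d I
    simp only [signHom_apply] at this
    rw [this]
    exact map_prod SignType.castHom _ _
  have hsplit : ∀ I : Finset ι, ((SignType.sign (∏ i ∈ I, d i) : SignType) : ℤ)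
      = (if 0 < ∏ i ∈ I, d i then 1 else 0) - if ∏ i ∈ I, d i < 0 then 1 else 0 := by
    intro I
    rcases lt_or_gt_of_ne (hprod I) with h | h <;> simp [h, h.not_gt]
  simp only [hsplit, Finset.sum_sub_distrib, Finset.sum_boole] at hsum
  have hcard := Finset.card_filter_add_card_filter_not (s := (Finset.univ : Finset (Finset ι)))
    (fun I => 0 < ∏ i ∈ I, d i)
  have hnot : ∀ I : Finset ι, (¬ 0 < ∏ i ∈ I, d i) ↔ ∏ i ∈ I, d i < 0 := fun I =>
    ⟨fun h => lt_of_le_of_ne (not_lt.mp h) (hprod I), fun h => h.not_gt⟩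
  simp only [hnot, Finset.card_univ, Fintype.card_finset] at hcard
  have hpos : 0 < Fintype.card ι := Fintype.card_pos_iff.mpr ⟨i₀⟩
  obtain ⟨m, hm⟩ := Nat.exists_eq_succ_of_ne_zero hpos.ne'
  rw [hm, pow_succ] at hcard
  rw [hm, Nat.succ_sub_one]
  constructor <;> omega

section ConjugationForms

variable {W : Type*} [AddCommGroup W] [Module ℂ W]

theorem form_fixed_eq_re {B : LinearMap.BilinForm ℂ W} {s : W →ₛₗ[starRingEnd ℂ] W}
    (hBs : ∀ x y, B (s x) (s y) = starRingEnd ℂ (B x y)) {x y : W} (hx : s x = x) (hy : s y = y) :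
    B x y = ((B x y).re : ℂ) := by
  have h := hBs x y
  rw [hx, hy] at h
  exact (Complex.conj_eq_iff_re.mp h.symm).symm

/-- If the hermitian form `B (s x) y` attached to a conjugation `s` is positive definite on the
fixed points of another conjugation `c`, then it is positive definite. -/
theorem form_conj_self_pos [FiniteDimensional ℂ W] {B : LinearMap.BilinForm ℂ W}
    {s c : W →ₛₗ[starRingEnd ℂ] W}
    (hs : ∀ x, s (s x) = x) (hc : ∀ x, c (c x) = x)
    (hBs : ∀ x y, B (s x) (s y) = starRingEnd ℂ (B x y))
    (hBc : ∀ x y, B (c x) (c y) = starRingEnd ℂ (B x y))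
    (hpos : ∀ x, c x = x → x ≠ 0 → 0 < (B (s x) x).re) {x : W} (hx : x ≠ 0) :
    0 < (B (s x) x).re := by
  have hpos' : ∀ x, c x = x → 0 ≤ (B (s x) x).re := fun x h => by
    by_cases h0 : x = 0
    · simp [h0]
    · exact (hpos x h h0).le
  have havg : ∀ w, w ≠ 0 → 0 < (B (s w) w).re + (B (s (c w)) (c w)).re := by
    intro w hw
    have h1 : c (w + c w) = w + c w := by rw [map_add, hc, add_comm]
    have h2 : c (Complex.I • (w - c w)) = Complex.I • (w - c w) := by
      rw [map_smulₛₗ, map_sub, hc, Complex.conj_I, neg_smul, ← smul_neg, neg_sub]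
    have h3 : 2 * ((B (s w) w).re + (B (s (c w)) (c w)).re) = (B (s (w + c w)) (w + c w)).re
        + (B (s (Complex.I • (w - c w))) (Complex.I • (w - c w))).re := by
      have : B (s (Complex.I • (w - c w))) (Complex.I • (w - c w)) = B (s (w - c w)) (w - c w) := by
        simp only [map_smulₛₗ, LinearMap.smul_apply, smul_eq_mul, Complex.conj_I, RingHom.id_apply,
          ← mul_assoc]
        simp
      rw [this]
      simp only [map_add, map_sub, LinearMap.add_apply, LinearMap.sub_apply, Complex.add_re,
        Complex.sub_re]
      ring
    by_cases h0 : w + c w = 0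
    · have h4 : Complex.I • (w - c w) ≠ 0 := by
        rw [eq_neg_of_add_eq_zero_right h0, sub_neg_eq_add, ← two_smul ℂ w]
        simp [hw]
      linarith [hpos' _ h1, hpos _ h2 h4]
    · linarith [hpos _ h1 h0, hpos' _ h2]
  set J : W →ₗ[ℂ] W := s.comp c with hJdef
  have hJ : ∀ y, J y = s (c y) := fun y => rfl
  have hself : ∀ u v, B (s (J u)) v = B (s u) (J v) := by
    intro u v
    rw [hJ, hJ, hs, hBs, ← hBc, hc]
  have hG : ∀ y, y ≠ 0 → 0 < (B (s (y + J (J y))) y).re := by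
    intro y hy
    have h1 : B (s (c y)) (c y) = starRingEnd ℂ (B (s (J (J y))) y) := by
      rw [hJ, hJ, hs, ← hBc, hc]
    have h2 := havg y hy
    rw [h1, Complex.conj_re] at h2
    rwa [map_add, map_add, LinearMap.add_apply, Complex.add_re]
  have hJ0 : ∀ y, y ≠ 0 → J y ≠ 0 := by
    intro y hy h
    rw [hJ] at h
    apply hy
    rw [← hc y, ← hs (c y), h, map_zero, map_zero]
  have hinj : Function.Injective (LinearMap.id + J ∘ₗ J : W →ₗ[ℂ] W) := by
    rw [← LinearMap.ker_eq_bot, LinearMap.ker_eq_bot']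
    intro y hy
    by_contra h0
    have h := hG y h0
    have hy' : y + J (J y) = 0 := hy
    rw [hy'] at h
    simp at h
  obtain ⟨y, rfl⟩ := LinearMap.surjective_of_injective hinj x
  have hy : y ≠ 0 := by rintro rfl; simp at hx
  have hval : B (s (y + J (J y))) (y + J (J y))
      = B (s (y + J (J y))) y + B (s (J y + J (J (J y)))) (J y) := by
    rw [(B (s (y + J (J y)))).map_add, ← map_add J, hself]
  change 0 < (B (s (y + J (J y))) (y + J (J y))).re
  rw [hval, Complex.add_re]
  exact add_pos (hG y hy) (hG _ (hJ0 y hy))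

/-- A conjugation compatible with a nondegenerate symmetric bilinear form admits an orthogonal
basis of fixed vectors. -/
theorem exists_orthogonal_basis_fixed [FiniteDimensional ℂ W] {B : LinearMap.BilinForm ℂ W}
    (hB : ∀ x y, B x y = B y x) (hnd : ∀ x, (∀ y, B x y = 0) → x = 0)
    {s : W →ₛₗ[starRingEnd ℂ] W} (hs : ∀ x, s (s x) = x)
    (hBs : ∀ x y, B (s x) (s y) = starRingEnd ℂ (B x y)) {n : ℕ}
    (hn : Module.finrank ℂ W = n) :
    ∃ e : Module.Basis (Fin n) ℂ W,
      (∀ i, s (e i) = e i) ∧ (∀ i j, i ≠ j → B (e i) (e j) = 0) ∧ ∀ i, B (e i) (e i) ≠ 0 := by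
  let F : Submodule ℝ W :=
    { carrier := {x | s x = x}
      add_mem' := fun {a b} ha hb => by
        simp only [Set.mem_ofPred_eq] at *
        rw [map_add, ha, hb]
      zero_mem' := map_zero s
      smul_mem' := fun r x hx => by
        simp only [Set.mem_ofPred_eq] at *
        rw [← Complex.coe_smul, map_smulₛₗ, hx, Complex.conj_ofReal] }
  have hF : ∀ x : F, s x = x := fun x => x.2
  let β : LinearMap.BilinForm ℝ F := LinearMap.mk₂ ℝ (fun x y => (B x y).re)
    (by intros; simp) (by
      intro c x y
      rw [Submodule.coe_smul, ← Complex.coe_smul]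
      simp) (by intros; simp) (by
      intro c x y
      rw [Submodule.coe_smul, ← Complex.coe_smul]
      simp)
  have hβ : ∀ x y : F, B x y = (β x y : ℂ) := fun x y => form_fixed_eq_re hBs (hF x) (hF y)
  have : FiniteDimensional ℝ W := FiniteDimensional.complexToReal W
  obtain ⟨v, hv⟩ := LinearMap.BilinForm.exists_orthogonal_basis (B := β)
    ⟨fun x y => by simp [β, hB (x : W)]⟩
  have hortho : ∀ i j, i ≠ j → B (v i : W) (v j) = 0 := by
    intro i j hij
    rw [hβ, show β (v i) (v j) = 0 from hv hij, Complex.ofReal_zero]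
  have hspan : ⊤ ≤ Submodule.span ℂ (Set.range fun i => (v i : W)) := by
    have hmem : ∀ x, s x = x → x ∈ Submodule.span ℂ (Set.range fun i => (v i : W)) := by
      intro x hx
      have h := congrArg F.subtype (v.sum_repr ⟨x, hx⟩)
      simp only [map_sum, map_smul, Submodule.subtype_apply] at h
      rw [← h]
      refine sum_mem fun i _ => ?_
      rw [← Complex.coe_smul]
      exact Submodule.smul_mem _ _ (Submodule.subset_span ⟨i, rfl⟩)
    intro w _
    have h1 := hmem (w + s w) (by rw [map_add, hs, add_comm])
    have h2 := hmem (Complex.I • (w - s w)) (by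
      rw [map_smulₛₗ, map_sub, hs, Complex.conj_I, neg_smul, ← smul_neg, neg_sub])
    have h3 : w = (1 / 2 : ℂ) • (w + s w) + (-Complex.I / 2) • Complex.I • (w - s w) := by
      rw [smul_smul]
      have : -Complex.I / 2 * Complex.I = 1 / 2 := by
        linear_combination (-1 / 2 : ℂ) * Complex.I_mul_I
      rw [this]
      module
    rw [h3]
    exact add_mem (Submodule.smul_mem _ _ h1) (Submodule.smul_mem _ _ h2)
  have hne : ∀ i, B (v i : W) (v i) ≠ 0 := by
    intro i hi
    refine v.ne_zero i (Subtype.ext (hnd _ fun y => ?_))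
    have hle : Submodule.span ℂ (Set.range fun i => (v i : W)) ≤ LinearMap.ker (B (v i)) := by
      rw [Submodule.span_le]
      rintro _ ⟨j, rfl⟩
      by_cases hij : i = j
      · subst hij; exact hi
      · exact hortho i j hij
    exact hle (hspan (Submodule.mem_top (x := y)))
  have hli : LinearIndependent ℂ fun i => (v i : W) :=
    LinearMap.linearIndependent_of_isOrthoᵢ (B := B) (fun i j hij => hortho i j hij) hne
  let e := Module.Basis.mk hli hspan
  have hcard : Module.finrank ℝ F = n := by
    rw [← hn, Module.finrank_eq_card_basis e, Fintype.card_fin]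
  refine ⟨e.reindex (finCongr hcard), ?_, ?_, ?_⟩
  · intro i; simp [e, hF]
  · intro i j hij
    simpa [e] using hortho _ _ (by simpa using hij)
  · intro i
    simpa [e] using hne _

end ConjugationForms

section ComplexifiedForm

/-- Complex conjugation on the complexification `ℂ ⊗ V`. -/
def conjTensor (V : Type*) [AddCommGroup V] [Module ℝ V] :
    (ℂ ⊗[ℝ] V) →ₛₗ[starRingEnd ℂ] (ℂ ⊗[ℝ] V) where
  toFun := TensorProduct.map Complex.conjAe.toLinearMap LinearMap.id
  map_add' := map_add _
  map_smul' z x := by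
    induction x with
    | zero => simp
    | tmul a v => simp [TensorProduct.smul_tmul']
    | add x y hx hy => rw [smul_add, map_add, hx, hy, map_add, smul_add]

@[simp]
theorem conjTensor_tmul (z : ℂ) (v : V) :
    conjTensor V (z ⊗ₜ[ℝ] v) = starRingEnd ℂ z ⊗ₜ[ℝ] v := rfl

theorem conjTensor_conjTensor (x : ℂ ⊗[ℝ] V) : conjTensor V (conjTensor V x) = x := by
  induction x with
  | zero => simp
  | tmul a v => simp
  | add x y hx hy => rw [map_add, map_add, hx, hy]

theorem exists_eq_re_add_im (x : ℂ ⊗[ℝ] V) :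
    ∃ a b : V, x = (1 : ℂ) ⊗ₜ[ℝ] a + Complex.I ⊗ₜ[ℝ] b := by
  induction x with
  | zero => exact ⟨0, 0, by simp⟩
  | tmul z v =>
    refine ⟨z.re • v, z.im • v, ?_⟩
    rw [← TensorProduct.smul_tmul, ← TensorProduct.smul_tmul, ← TensorProduct.add_tmul]
    congr 1
    rw [Complex.real_smul, Complex.real_smul, mul_one, Complex.re_add_im]
  | add x y hx hy =>
    obtain ⟨a, b, rfl⟩ := hx
    obtain ⟨a', b', rfl⟩ := hy
    exact ⟨a + a', b + b', by simp only [TensorProduct.tmul_add]; abel⟩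

theorem exists_eq_one_tmul_of_conjTensor_eq {x : ℂ ⊗[ℝ] V} (hx : conjTensor V x = x) :
    ∃ v : V, x = (1 : ℂ) ⊗ₜ[ℝ] v := by
  obtain ⟨a, b, rfl⟩ := exists_eq_re_add_im x
  refine ⟨a, ?_⟩
  simp only [map_add, conjTensor_tmul, map_one, Complex.conj_I, TensorProduct.neg_tmul] at hx
  have h2 : (2 : ℂ) • (Complex.I ⊗ₜ[ℝ] b) = 0 := by
    rw [two_smul]
    nth_rewrite 1 [← add_left_cancel hx]
    exact neg_add_cancel _
  rw [(smul_eq_zero.mp h2).resolve_left two_ne_zero, add_zero]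

theorem polar_baseChange_tmul (Q : QuadraticForm ℝ V) (z w : ℂ) (a b : V) :
    (Q.baseChange ℂ).polarBilin (z ⊗ₜ[ℝ] a) (w ⊗ₜ[ℝ] b) = w * z * QuadraticMap.polar Q a b := by
  rw [QuadraticForm.polarBilin_baseChange, LinearMap.BilinForm.baseChange_tmul]
  simp [mul_comm]

theorem polar_baseChange_conjTensor (Q : QuadraticForm ℝ V) (x y : ℂ ⊗[ℝ] V) :
    (Q.baseChange ℂ).polarBilin (conjTensor V x) (conjTensor V y)
      = starRingEnd ℂ ((Q.baseChange ℂ).polarBilin x y) := by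
  obtain ⟨a, b, rfl⟩ := exists_eq_re_add_im x
  obtain ⟨a', b', rfl⟩ := exists_eq_re_add_im y
  simp only [map_add, LinearMap.add_apply, conjTensor_tmul, polar_baseChange_tmul, map_mul,
    map_one, Complex.conj_I, Complex.conj_ofReal]

theorem polar_baseChange_nondegenerate {Q : QuadraticForm ℝ V} (hQ : QFNondeg Q)
    {x : ℂ ⊗[ℝ] V} (hx : ∀ y, (Q.baseChange ℂ).polarBilin x y = 0) : x = 0 := by
  obtain ⟨a, b, rfl⟩ := exists_eq_re_add_im x
  have key : ∀ w, QuadraticMap.polar Q a w = 0 ∧ QuadraticMap.polar Q b w = 0 := by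
    intro w
    have h := hx ((1 : ℂ) ⊗ₜ w)
    rw [map_add, LinearMap.add_apply, polar_baseChange_tmul, polar_baseChange_tmul,
      Complex.ext_iff] at h
    simpa using h
  rw [hQ a fun w => (key w).1, hQ b fun w => (key w).2]
  simp

end ComplexifiedForm

section RealStructureOnVectors

variable {Q : QuadraticForm ℝ V}

theorem algebraMap_CCl_injective {τ : CCl Q →ₗ[ℂ] ℂ} (hτ1 : τ 1 = 1) :
    Function.Injective (algebraMap ℂ (CCl Q)) := by
  intro a b h
  have h' := congrArg τ h
  simpa [Algebra.algebraMap_eq_smul_one, hτ1] using h'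

theorem ι_baseChange_injective (hQ : QFNondeg Q) {τ : CCl Q →ₗ[ℂ] ℂ} (hτ1 : τ 1 = 1) :
    Function.Injective (CliffordAlgebra.ι (Q.baseChange ℂ)) := by
  rw [← LinearMap.ker_eq_bot, LinearMap.ker_eq_bot']
  intro x hx
  refine polar_baseChange_nondegenerate hQ fun y => algebraMap_CCl_injective hτ1 ?_
  rw [QuadraticMap.polarBilin_apply_apply, ← CliffordAlgebra.ι_mul_ι_add_swap, hx]
  simp

namespace RealStructure

theorem map_algebraMap (σ : RealStructure Q) (z : ℂ) :
    σ.toFun (algebraMap ℂ (CCl Q) z) = algebraMap ℂ (CCl Q) (starRingEnd ℂ z) := by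
  rw [Algebra.algebraMap_eq_smul_one, σ.map_smul', σ.map_one', ← Algebra.algebraMap_eq_smul_one]

theorem exists_restriction (hQ : QFNondeg Q) {τ : CCl Q →ₗ[ℂ] ℂ} (hτ1 : τ 1 = 1)
    (σ : RealStructure Q) : ∃ s : (ℂ ⊗[ℝ] V) →ₛₗ[starRingEnd ℂ] (ℂ ⊗[ℝ] V),
      (∀ x, CliffordAlgebra.ι (Q.baseChange ℂ) (s x)
        = σ.toFun (CliffordAlgebra.ι (Q.baseChange ℂ) x)) ∧
      (∀ x, s (s x) = x) ∧
      ∀ x y, (Q.baseChange ℂ).polarBilin (s x) (s y)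
        = starRingEnd ℂ ((Q.baseChange ℂ).polarBilin x y) := by
  have hinj := ι_baseChange_injective hQ hτ1
  have hex : ∀ x, ∃ y, CliffordAlgebra.ι (Q.baseChange ℂ) y
      = σ.toFun (CliffordAlgebra.ι (Q.baseChange ℂ) x) := fun x => σ.stable _ ⟨x, rfl⟩
  choose s hs using hex
  refine ⟨{ toFun := s, map_add' := fun x y => hinj ?_, map_smul' := fun z x => hinj ?_ },
    hs, fun x => hinj ?_, fun x y => algebraMap_CCl_injective hτ1 ?_⟩
  · rw [hs, map_add, map_add, σ.map_add', hs, hs]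
  · rw [hs, map_smul, map_smul, σ.map_smul', hs]
  · change CliffordAlgebra.ι (Q.baseChange ℂ) (s (s x)) = _
    rw [hs, hs, σ.invol]
  · change algebraMap ℂ (CCl Q) ((Q.baseChange ℂ).polarBilin (s x) (s y)) = _
    rw [← σ.map_algebraMap, QuadraticMap.polarBilin_apply_apply,
      QuadraticMap.polarBilin_apply_apply, ← CliffordAlgebra.ι_mul_ι_add_swap,
      ← CliffordAlgebra.ι_mul_ι_add_swap, σ.map_add', σ.map_mul', σ.map_mul', hs, hs]

theorem map_list_prod (σ : RealStructure Q) (l : List (CCl Q)) (hl : ∀ x ∈ l, σ.toFun x = x) :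
    σ.toFun l.prod = l.prod := by
  induction l with
  | nil => exact σ.map_one'
  | cons a t ih =>
    rw [List.prod_cons, σ.map_mul', hl a (by simp), ih fun x hx => hl x (by simp [hx])]

theorem map_sum (σ : RealStructure Q) {κ : Type*} (t : Finset κ) (f : κ → CCl Q) :
    σ.toFun (∑ k ∈ t, f k) = ∑ k ∈ t, σ.toFun (f k) :=
  _root_.map_sum (AddMonoidHom.mk' σ.toFun σ.map_add') f t

end RealStructure

theorem sprod_sum_smul (σ : RealStructure Q) (τ : CCl Q →ₗ[ℂ] ℂ) {κ : Type*} [Fintype κ]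
    (b : κ → CCl Q) (x y : κ → ℂ) :
    sprod σ τ (∑ k, x k • b k) (∑ l, y l • b l)
      = ∑ k, ∑ l, starRingEnd ℂ (x k) * y l * sprod σ τ (b k) (b l) := by
  simp only [sprod, map_sum, map_smul, σ.map_sum, σ.map_smul', Finset.sum_mul_sum, smul_eq_mul,
    smul_mul_smul_comm]

theorem map_reverse_orderedMonomial (σ : RealStructure Q) {ι : Type*} [LinearOrder ι]
    {e : ι → ℂ ⊗[ℝ] V}
    (he : ∀ i, σ.toFun (CliffordAlgebra.ι (Q.baseChange ℂ) (e i))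
      = CliffordAlgebra.ι (Q.baseChange ℂ) (e i)) (I : Finset ι) :
    σ.toFun (CliffordAlgebra.reverse
        (orderedMonomial (fun i => CliffordAlgebra.ι (Q.baseChange ℂ) (e i)) I))
      = reversedMonomial (fun i => CliffordAlgebra.ι (Q.baseChange ℂ) (e i)) I := by
  have h : CliffordAlgebra.reverse
        (orderedMonomial (fun i => CliffordAlgebra.ι (Q.baseChange ℂ) (e i)) I)
      = reversedMonomial (fun i => CliffordAlgebra.ι (Q.baseChange ℂ) (e i)) I := by
    have := CliffordAlgebra.reverse_prod_map_ι (Q := Q.baseChange ℂ) (I.sort.map e)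
    rwa [List.map_map, ← List.map_reverse] at this
  rw [h]
  refine σ.map_list_prod _ fun x hx => ?_
  obtain ⟨i, -, rfl⟩ := List.mem_map.mp hx
  exact he i

/-- A basis of `ℂl(V)` diagonalizing the `σ`-product, whose diagonal entries are the products of
the squares of the vectors of a `σ`-fixed orthogonal basis. -/
theorem exists_diagonal_basis [FiniteDimensional ℝ V] (hdim : Even (Module.finrank ℝ V))
    (hQ : QFNondeg Q) {τ : CCl Q →ₗ[ℂ] ℂ} (hτ1 : τ 1 = 1)
    (hτtr : ∀ a b : CCl Q, τ (a * b) = τ (b * a)) (σ : RealStructure Q) :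
    ∃ (e : Module.Basis (Fin (Module.finrank ℝ V)) ℂ (ℂ ⊗[ℝ] V))
      (d : Fin (Module.finrank ℝ V) → ℝ)
      (b : Module.Basis (Finset (Fin (Module.finrank ℝ V))) ℂ (CCl Q)),
      (∀ i, σ.toFun (CliffordAlgebra.ι (Q.baseChange ℂ) (e i))
        = CliffordAlgebra.ι (Q.baseChange ℂ) (e i)) ∧
      (∀ i j, (Q.baseChange ℂ).polarBilin (e i) (e j) = if i = j then 2 * (d i : ℂ) else 0) ∧
      (∀ i, d i ≠ 0) ∧
      ∀ x y, sprod σ τ x y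
        = ∑ I, starRingEnd ℂ (b.repr x I) * b.repr y I * (∏ i ∈ I, d i : ℝ) := by
  obtain ⟨s, hsι, hs, hsB⟩ := σ.exists_restriction hQ hτ1
  have hBsymm : ∀ x y, (Q.baseChange ℂ).polarBilin x y = (Q.baseChange ℂ).polarBilin y x :=
    fun x y => QuadraticMap.polar_comm _ _ _
  obtain ⟨e, he, hortho, hne⟩ := exists_orthogonal_basis_fixed hBsymm
    (fun x => polar_baseChange_nondegenerate hQ) hs hsB
    (Module.finrank_baseChange (R := ℂ) (S := ℝ))
  have hre : ∀ i, (Q.baseChange ℂ).polarBilin (e i) (e i)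
      = (((Q.baseChange ℂ).polarBilin (e i) (e i)).re : ℂ) :=
    fun i => form_fixed_eq_re hsB (he i) (he i)
  let d : Fin (Module.finrank ℝ V) → ℝ :=
    fun i => ((Q.baseChange ℂ).polarBilin (e i) (e i)).re / 2
  have hd : ∀ i, (Q.baseChange ℂ).polarBilin (e i) (e i) = 2 * (d i : ℂ) := by
    intro i
    rw [hre]
    simp only [d]
    push_cast
    ring
  have hd0 : ∀ i, (d i : ℂ) ≠ 0 := by
    intro i h
    exact hne i (by rw [hd, h, mul_zero])
  have hfix : ∀ i, σ.toFun (CliffordAlgebra.ι (Q.baseChange ℂ) (e i))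
      = CliffordAlgebra.ι (Q.baseChange ℂ) (e i) := by
    intro i
    rw [← hsι, he]
  set g : Fin (Module.finrank ℝ V) → CCl Q :=
    fun i => CliffordAlgebra.ι (Q.baseChange ℂ) (e i) with hg
  have hsq : ∀ i, g i * g i = algebraMap ℂ (CCl Q) (d i) := by
    intro i
    have h := hd i
    rw [QuadraticMap.polarBilin_apply_apply, QuadraticMap.polar_self, two_smul, ← two_mul] at h
    rw [hg, CliffordAlgebra.ι_sq_scalar, mul_left_cancel₀ two_ne_zero h]
  have hanti : ∀ i j, i ≠ j → g i * g j = -(g j * g i) := by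
    intro i j hij
    have h := hortho i j hij
    rw [QuadraticMap.polarBilin_apply_apply] at h
    rw [← add_eq_zero_iff_eq_neg, hg, CliffordAlgebra.ι_mul_ι_add_swap, h, map_zero]
  have hgen : Algebra.adjoin ℂ (Set.range g) = ⊤ := by
    rw [eq_top_iff, ← CliffordAlgebra.adjoin_range_ι, Algebra.adjoin_le_iff]
    rintro _ ⟨x, rfl⟩
    rw [← e.sum_repr x, map_sum]
    refine sum_mem fun i _ => ?_
    rw [map_smul]
    exact Subalgebra.smul_mem _ (Algebra.subset_adjoin (Set.mem_range_self (f := g) i)) _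
  have hcard : Even (Fintype.card (Fin (Module.finrank ℝ V))) := by rwa [Fintype.card_fin]
  let b := Module.Basis.mk
    (linearIndependent_orderedMonomial hcard hsq hanti hd0 τ hτ1 hτtr)
    (span_orderedMonomial_eq_top hsq hanti hgen)
  have hsprod : ∀ I J, sprod σ τ (b I) (b J)
      = if I = J then ((∏ i ∈ I, d i : ℝ) : ℂ) else 0 := by
    intro I J
    rw [Module.Basis.mk_apply, Module.Basis.mk_apply, sprod, map_reverse_orderedMonomial σ hfix,
      trace_reversedMonomial_mul_orderedMonomial hcard hsq hanti hd0 τ hτ1 hτtr,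
      Complex.ofReal_prod]
  refine ⟨e, d, b, hfix, fun i j => ?_, fun i => by exact_mod_cast hd0 i, fun x y => ?_⟩
  · split_ifs with h
    · rw [← h, hd]
    · exact hortho i j h
  · conv_lhs => rw [← b.sum_repr x, ← b.sum_repr y]
    rw [sprod_sum_smul]
    simp only [hsprod, mul_ite, mul_zero, Finset.sum_ite_eq, Finset.mem_univ, if_true]

theorem polar_conj_ιr {τ : CCl Q →ₗ[ℂ] ℂ} (hτ1 : τ 1 = 1) {σ : RealStructure Q} {Qσ : V → ℝ}
    (hQσ : ∀ v : V, σ.toFun (ιr Q v) * ιr Q v + ιr Q v * σ.toFun (ιr Q v)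
        = algebraMap ℂ (CCl Q) ((2 * Qσ v : ℝ) : ℂ))
    {s : (ℂ ⊗[ℝ] V) → (ℂ ⊗[ℝ] V)}
    (hs : ∀ x, CliffordAlgebra.ι (Q.baseChange ℂ) (s x)
        = σ.toFun (CliffordAlgebra.ι (Q.baseChange ℂ) x)) (v : V) :
    (Q.baseChange ℂ).polarBilin (s ((1 : ℂ) ⊗ₜ[ℝ] v)) ((1 : ℂ) ⊗ₜ[ℝ] v)
      = ((2 * Qσ v : ℝ) : ℂ) := by
  refine algebraMap_CCl_injective hτ1 ?_
  rw [← hQσ, QuadraticMap.polarBilin_apply_apply, ← CliffordAlgebra.ι_mul_ι_add_swap, hs]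
  rfl

/-- The form `Q_σ` is positive definite on `V` exactly when the vectors of a `σ`-fixed orthogonal
basis of `V^ℂ` have positive squares. -/
theorem forall_pos_iff_of_fixed_orthogonal_basis [FiniteDimensional ℝ V] (hQ : QFNondeg Q)
    {τ : CCl Q →ₗ[ℂ] ℂ} (hτ1 : τ 1 = 1) {σ : RealStructure Q} {Qσ : V → ℝ}
    (hQσ : ∀ v : V, σ.toFun (ιr Q v) * ιr Q v + ιr Q v * σ.toFun (ιr Q v)
        = algebraMap ℂ (CCl Q) ((2 * Qσ v : ℝ) : ℂ))
    {ι : Type*} [Fintype ι] [DecidableEq ι] (e : Module.Basis ι ℂ (ℂ ⊗[ℝ] V)) {d : ι → ℝ}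
    (he : ∀ i, σ.toFun (CliffordAlgebra.ι (Q.baseChange ℂ) (e i))
        = CliffordAlgebra.ι (Q.baseChange ℂ) (e i))
    (hd : ∀ i j, (Q.baseChange ℂ).polarBilin (e i) (e j) = if i = j then 2 * (d i : ℂ) else 0) :
    (∀ v : V, v ≠ 0 → 0 < Qσ v) ↔ ∀ i, 0 < d i := by
  obtain ⟨s, hsι, hs, hsB⟩ := σ.exists_restriction hQ hτ1
  have hse : ∀ i, s (e i) = e i := fun i => ι_baseChange_injective hQ hτ1 (by rw [hsι, he])
  have hval := polar_conj_ιr hτ1 hQσ hsι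
  constructor
  · intro h i
    have hpos := form_conj_self_pos hs conjTensor_conjTensor hsB (polar_baseChange_conjTensor Q)
      (fun x hx hx0 => by
        obtain ⟨v, rfl⟩ := exists_eq_one_tmul_of_conjTensor_eq hx
        rw [hval, Complex.ofReal_re]
        have := h v (by rintro rfl; simp at hx0)
        linarith) (e.ne_zero i)
    rw [hse, hd, if_pos rfl] at hpos
    simpa using hpos
  · intro h v hv
    set x : ℂ ⊗[ℝ] V := (1 : ℂ) ⊗ₜ[ℝ] v with hx
    have hx0 : x ≠ 0 := by
      intro h0
      refine hv (hQ v fun w => ?_)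
      have h1 := polar_baseChange_tmul Q 1 1 v w
      rw [← hx, h0] at h1
      simpa using h1.symm
    have hB : ∀ x y : ℂ ⊗[ℝ] V, (Q.baseChange ℂ).polarBilin (s x) y
        = ∑ i, starRingEnd ℂ (e.repr x i) * e.repr y i * (2 * d i : ℝ) := by
      intro x y
      conv_lhs => rw [← e.sum_repr x, ← e.sum_repr y]
      simp only [map_sum, map_smulₛₗ, hse, LinearMap.sum_apply, LinearMap.smul_apply, hd,
        smul_eq_mul, RingHom.id_apply, mul_ite, mul_zero, Finset.sum_ite_eq', Finset.mem_univ,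
        if_true]
      refine Finset.sum_congr rfl fun i _ => ?_
      push_cast
      ring
    obtain ⟨r, hr, h1⟩ := diagonal_form_self_pos e (fun i => 2 * d i) hB (s := Set.univ)
      (fun i _ => mul_pos two_pos (h i)) (x := x) (by simp [e.span_eq]) hx0
    rw [hval, Complex.ofReal_inj] at h1
    linarith

end RealStructureOnVectors

/-- **Garling's alternative.** If `Q_σ` is positive definite then the σ-product
is positive definite; otherwise the σ-product is neutral of signature `(2^{n−1}, 2^{n−1})`. -/
theorem statement8 [FiniteDimensional ℝ V] (Q : QuadraticForm ℝ V)
    (hdim : Even (Module.finrank ℝ V)) (hQ : QFNondeg Q)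
    (τ : CCl Q →ₗ[ℂ] ℂ) (hτ1 : τ 1 = 1) (hτtr : ∀ a b : CCl Q, τ (a * b) = τ (b * a))
    (σ : RealStructure Q)
    (Qσ : V → ℝ)
    (hQσ : ∀ v : V, σ.toFun (ιr Q v) * ιr Q v + ιr Q v * σ.toFun (ιr Q v)
        = algebraMap ℂ (CCl Q) ((2 * Qσ v : ℝ) : ℂ)) :
    -- if Q_σ is positive definite, the σ-product is positive definite
    ((∀ v : V, v ≠ 0 → 0 < Qσ v) → FPosDef (sprod σ τ))
    -- otherwise it is nondegenerate of signature (2^{n-1}, 2^{n-1})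
    ∧ (¬ (∀ v : V, v ≠ 0 → 0 < Qσ v) →
        (∀ a : CCl Q, (∀ b : CCl Q, sprod σ τ a b = 0) → a = 0)
        ∧ ∃ P N : Submodule ℂ (CCl Q), P ⊓ N = ⊥ ∧ P ⊔ N = ⊤
            ∧ (∀ x ∈ P, ∀ y ∈ N, sprod σ τ x y = 0)
            ∧ (∀ x ∈ P, x ≠ 0 → ∃ r : ℝ, 0 < r ∧ sprod σ τ x x = r)
            ∧ (∀ y ∈ N, y ≠ 0 → ∃ r : ℝ, r < 0 ∧ sprod σ τ y y = r)
            ∧ Module.finrank ℂ P = 2 ^ (Module.finrank ℝ V - 1)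
            ∧ Module.finrank ℂ N = 2 ^ (Module.finrank ℝ V - 1)) := by
  obtain ⟨e, d, b, he, hd, hd0, hb⟩ := exists_diagonal_basis hdim hQ hτ1 hτtr σ
  have hiff := forall_pos_iff_of_fixed_orthogonal_basis hQ hτ1 hQσ e he hd
  have hprod : ∀ I, ∏ i ∈ I, d i ≠ 0 := fun I => Finset.prod_ne_zero_iff.mpr fun i _ => hd0 i
  rw [hiff]
  constructor
  · intro hpos x hx
    exact diagonal_form_self_pos b _ hb (s := Set.univ)
      (fun I _ => Finset.prod_pos fun i _ => hpos i) (by simp [b.span_eq]) hx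
  · intro hneg
    push Not at hneg
    obtain ⟨i₀, hi₀⟩ := hneg
    obtain ⟨hcardP, hcardN⟩ := card_prod_pos_and_prod_neg hd0 (lt_of_le_of_ne hi₀ (hd0 i₀))
    rw [Fintype.card_fin] at hcardP hcardN
    let p : Finset (Finset (Fin (Module.finrank ℝ V))) := {I | 0 < ∏ i ∈ I, d i}
    let q : Finset (Finset (Fin (Module.finrank ℝ V))) := {I | ∏ i ∈ I, d i < 0}
    have hdisj : Disjoint (p : Set (Finset (Fin (Module.finrank ℝ V)))) q := by
      rw [Set.disjoint_left]
      intro I h1 h2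
      exact lt_asymm (Finset.mem_filter.mp h1).2 (Finset.mem_filter.mp h2).2
    refine ⟨fun a ha => diagonal_form_nondegenerate b hprod hb ha,
      Submodule.span ℂ (b '' p), Submodule.span ℂ (b '' q), ?_, ?_, ?_, ?_, ?_, ?_, ?_⟩
    · exact (b.linearIndependent.disjoint_span_image hdisj).eq_bot
    · rw [← Submodule.span_union, ← Set.image_union, ← b.span_eq, ← Set.image_univ]
      congr 2
      ext I
      rcases lt_or_gt_of_ne (hprod I) with h | h <;> simp [p, q, h]
    · exact fun x hx y hy => diagonal_form_eq_zero_of_disjoint b _ hb hdisj hx hy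
    · exact fun x hx hx0 => diagonal_form_self_pos b _ hb (by simp [p]) hx hx0
    · exact fun x hx hx0 => diagonal_form_self_neg b _ hb (by simp [q]) hx hx0
    · rw [finrank_span_basis_image, hcardP]
    · rw [finrank_span_basis_image, hcardN]
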